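/- Dichotomy theorem: Let G be a graph. For every divisor D ∈ Div(G), exactly one of the following holds: (N1) r(D) ≥ 0 (i.e., D is linearly equivalent to an effective divisor); or (N2) r(ν_P − D) ≥ 0 for some linear (total) order <_P on V(G) (i.e., ν_P − D is linearly equivalent to an effective divisor for some order <_P). -/

import Mathlib

open Finset

variable {V : Type}

/-- Degree of a vertex in the multigraph with edge multiplicities `m`. -/
def mdeg [Fintype V] (m : V → V → ℕ) (v : V) : ℕ := ∑ w, m v w

/-- The Laplacian of an integer-valued function on the vertices. -/
def laplacian [Fintype V] (m : V → V → ℕ) (f : V → ℤ) : V → ℤ :=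
  fun v => (mdeg m v : ℤ) * f v - ∑ w, (m v w : ℤ) * f w

/-- Linear equivalence of divisors. -/
def LinEquiv [Fintype V] (m : V → V → ℕ) (D D' : V → ℤ) : Prop :=
  ∃ f : V → ℤ, D - D' = laplacian m f

/-- A divisor is effective if it is nonnegative everywhere. -/
def Effective (D : V → ℤ) : Prop := ∀ v, 0 ≤ D v

/-- Degree of a divisor. -/
def divDeg [Fintype V] (D : V → ℤ) : ℤ := ∑ v, D v

/-- `D` is linearly equivalent to some effective divisor. -/
def Winnable [Fintype V] (m : V → V → ℕ) (D : V → ℤ) : Prop :=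
  ∃ E, Effective E ∧ LinEquiv m D E

/-- Number of edges of the multigraph. -/
def edgeCount [Fintype V] (m : V → V → ℕ) : ℤ := (∑ v, ∑ w, (m v w : ℤ)) / 2

/-- The genus `g = |E| - |V| + 1`. -/
def genus [Fintype V] (m : V → V → ℕ) : ℤ := edgeCount m - Fintype.card V + 1

/-- `m` describes a graph: symmetric, loopless, and connected. -/
def IsGraph [Fintype V] (m : V → V → ℕ) : Prop :=
  (∀ v w, m v w = m w v) ∧ (∀ v, m v v = 0) ∧
  (SimpleGraph.fromRel (fun v w => 0 < m v w)).Connected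


open Classical in
/-- The divisor `ν_P` associated to a (strict) linear order `r` on the vertices:
`ν_P(v) = (number of edges from `v` to vertices preceding `v`) - 1`. -/
noncomputable def nuP [Fintype V] (m : V → V → ℕ) (r : V → V → Prop) : V → ℤ :=
  fun v => (∑ w, if r w v then (m v w : ℤ) else 0) - 1

lemma lap_eq [Fintype V] (m : V → V → ℕ) (f : V → ℤ) (v : V) :
    laplacian m f v = ∑ w, (m v w : ℤ) * (f v - f w) := by
  simp [laplacian, mdeg, mul_sub, Finset.sum_sub_distrib, Finset.sum_mul]

lemma lap_add [Fintype V] (m : V → V → ℕ) (f g : V → ℤ) (v : V) :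
    laplacian m (f + g) v = laplacian m f v + laplacian m g v := by
  simp only [lap_eq, ← Finset.sum_add_distrib, Pi.add_apply]
  exact Finset.sum_congr rfl fun w _ => by ring

lemma lap_smul [Fintype V] (m : V → V → ℕ) (c : ℤ) (f : V → ℤ) (v : V) :
    laplacian m (fun x => c * f x) v = c * laplacian m f v := by
  simp only [lap_eq, Finset.mul_sum]
  exact Finset.sum_congr rfl fun w _ => by ring

lemma lap_symm [Fintype V] (m : V → V → ℕ) (hs : ∀ v w, m v w = m w v) (f g : V → ℤ) :
    ∑ v, f v * laplacian m g v = ∑ v, g v * laplacian m f v := by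
  simp only [laplacian, mul_sub, Finset.sum_sub_distrib, Finset.mul_sum]
  congr 1
  · exact Finset.sum_congr rfl fun w _ => by ring
  · rw [Finset.sum_comm]
    refine Finset.sum_congr rfl fun w _ => Finset.sum_congr rfl fun v _ => ?_
    rw [hs v w]; ring

lemma exists_pot [Fintype V] (m : V → V → ℕ) (hm : IsGraph m) (q : V) :
    ∃ h : V → ℤ, (∀ v, 0 ≤ h v) ∧ h q = 0 ∧ ∀ v, v ≠ q → 1 ≤ laplacian m h v := by
  classical
  obtain ⟨hs, hl, hc⟩ := hm
  set G := SimpleGraph.fromRel (fun v w => 0 < m v w) with hG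
  let d : V → ℕ := fun v => G.dist v q
  let L : ℕ := ∑ v, d v
  let K : ℤ := ∑ v, (mdeg m v : ℤ) + 1
  have hL : ∀ v, d v ≤ L := fun v =>
    Finset.single_le_sum (f := d) (fun _ _ => Nat.zero_le _) (Finset.mem_univ v)
  have hK : ∀ v, (mdeg m v : ℤ) + 1 ≤ K := fun v => by
    have := Finset.single_le_sum (f := fun v => (mdeg m v : ℤ))
      (fun _ _ => by positivity) (Finset.mem_univ v)
    simp only [K]; linarith
  have hK1 : 1 ≤ K := by
    have := hK q
    have : (0:ℤ) ≤ mdeg m q := by positivity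
    linarith [hK q]
  refine ⟨fun v => K ^ L - K ^ (L - d v), fun v => ?_, by simp [d], fun v hv => ?_⟩
  · have := pow_le_pow_right₀ hK1 (Nat.sub_le L (d v))
    linarith
  · obtain ⟨w, hw, hdw⟩ : ∃ w, 0 < m v w ∧ d w + 1 ≤ d v := by
      obtain ⟨p, hp⟩ := hc.exists_walk_length_eq_dist v q
      cases p with
      | nil => exact absurd rfl hv
      | cons h p =>
        rename_i w
        refine ⟨w, ?_, ?_⟩
        · rw [hG, SimpleGraph.fromRel_adj] at h
          rcases h.2 with h | h
          · exact h
          · rw [hs]; exact h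
        · have := SimpleGraph.dist_le p
          simp only [SimpleGraph.Walk.length_cons] at hp
          simp only [d]; omega
    have e : laplacian m (fun v => K ^ L - K ^ (L - d v)) v
        = ∑ w, (m v w : ℤ) * K ^ (L - d w) - mdeg m v * K ^ (L - d v) := by
      simp only [lap_eq, mdeg]
      push_cast
      rw [Finset.sum_mul, ← Finset.sum_sub_distrib]
      exact Finset.sum_congr rfl fun w _ => by ring
    rw [e]
    have h0 : ∀ j, (1:ℤ) ≤ K ^ j := fun j => one_le_pow₀ hK1
    have h1 : (m v w : ℤ) * K ^ (L - d w) ≤ ∑ w, (m v w : ℤ) * K ^ (L - d w) :=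
      Finset.single_le_sum (f := fun w => (m v w : ℤ) * K ^ (L - d w))
        (fun i _ => mul_nonneg (by positivity) (by linarith [h0 (L - d i)])) (Finset.mem_univ w)
    have h2 : K ^ (L - d v + 1) ≤ K ^ (L - d w) :=
      pow_le_pow_right₀ hK1 (by have := hL v; omega)
    have h3 : (1:ℤ) ≤ m v w := by exact_mod_cast hw
    have h4 : K ^ (L - d w) ≤ (m v w : ℤ) * K ^ (L - d w) := by
      nlinarith [h0 (L - d w)]
    rw [pow_succ] at h2
    nlinarith [h0 (L - d v), hK v]

open Classical in
lemma exists_rank [Fintype V] (m : V → V → ℕ) (D : V → ℤ)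
    (H : ∀ A : Finset V, A.Nonempty → ∃ v ∈ A, D v < ∑ w, if w ∉ A then (m v w : ℤ) else 0)
    (n : ℕ) : ∀ A : Finset V, A.card = n →
    ∃ ρ : V → ℕ, Set.InjOn ρ A ∧
      ∀ v ∈ A, D v < ∑ w, if (w ∉ A ∨ ρ w < ρ v) then (m v w : ℤ) else 0 := by
  induction n with
  | zero =>
    intro A hA
    rw [Finset.card_eq_zero] at hA
    subst hA
    exact ⟨fun _ => 0, by simp, by simp⟩
  | succ n ih =>
    intro A hA
    obtain ⟨v, hv, hlt⟩ := H A (Finset.card_pos.1 (by omega))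
    obtain ⟨ρ, hi, hρ⟩ := ih (A.erase v) (by rw [Finset.card_erase_of_mem hv]; omega)
    refine ⟨fun x => if x = v then 0 else ρ x + 1, ?_, ?_⟩
    · intro x hx y hy hxy
      by_cases h1 : x = v <;> by_cases h2 : y = v <;> simp [h1, h2] at hxy ⊢
      exact hi (by simpa [h1] using hx) (by simpa [h2] using hy) hxy
    · intro x hx
      by_cases h1 : x = v
      · subst h1
        simpa using hlt
      · refine (hρ x (by simp [h1, hx])).trans_le (Finset.sum_le_sum fun w _ => ?_)
        by_cases hw : w = v
        · simp only [hw, h1, if_true, if_false]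
          rw [if_pos (Or.inr (Nat.succ_pos (ρ x)))]
          split_ifs <;> simp
        · simp [hw, h1]

open Classical in
lemma not_winnable_nu [Fintype V] [Nonempty V] (m : V → V → ℕ) (r : V → V → Prop)
    (hr : IsStrictTotalOrder V r) (f : V → ℤ) : ∃ v, nuP m r v - laplacian m f v < 0 := by
  obtain ⟨x, hx⟩ := Finite.exists_max f
  have wf : WellFounded r := Finite.wellFounded_of_trans_of_irrefl r
  obtain ⟨v, hv, hmin⟩ := wf.has_min {v | f v = f x} ⟨x, rfl⟩
  refine ⟨v, ?_⟩
  have hle : (∑ w, if r w v then (m v w : ℤ) else 0) ≤ laplacian m f v := by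
    rw [lap_eq]
    refine Finset.sum_le_sum fun w _ => ?_
    have hv' : f v = f x := hv
    have h1 := hx w
    split_ifs with h
    · have h2 : f w ≠ f x := fun h' => hmin w h' h
      have h3 : 1 ≤ f v - f w := by omega
      nlinarith [Int.natCast_nonneg (m v w)]
    · exact mul_nonneg (by positivity) (by omega)
  simp only [nuP]
  linarith

open Classical in
lemma exists_reduced [Fintype V] (m : V → V → ℕ) (hm : IsGraph m) (D : V → ℤ) (q : V) :
    ∃ f : V → ℤ, (∀ v, v ≠ q → 0 ≤ D v - laplacian m f v) ∧
      ∀ A : Finset V, A.Nonempty → q ∉ A →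
        ∃ v ∈ A, D v - laplacian m f v < ∑ w, if w ∉ A then (m v w : ℤ) else 0 := by
  obtain ⟨h, h0, hq, h1⟩ := exists_pot m hm q
  obtain ⟨c, ⟨f, hf, hc⟩, hmax⟩ := Int.exists_greatest_of_bdd
    (P := fun c => ∃ f : V → ℤ, (∀ v, v ≠ q → 0 ≤ D v - laplacian m f v) ∧
      ∑ v, h v * laplacian m f v = c)
    (by
      refine ⟨∑ v, h v * D v, ?_⟩
      rintro _ ⟨f, hf, rfl⟩
      refine Finset.sum_le_sum fun v _ => ?_
      by_cases hv : v = q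
      · simp [hv, hq]
      · exact mul_le_mul_of_nonneg_left (by linarith [hf v hv]) (h0 v))
    (by
      refine ⟨_, fun x => (-∑ v, |D v|) * h x, fun v hv => ?_, rfl⟩
      rw [lap_smul]
      have a1 : |D v| ≤ ∑ v, |D v| :=
        Finset.single_le_sum (f := fun v => |D v|) (fun _ _ => abs_nonneg _) (Finset.mem_univ v)
      have a2 := neg_abs_le (D v)
      have a3 := abs_nonneg (D v)
      nlinarith [h1 v hv])
  refine ⟨f, hf, fun A hA hqA => ?_⟩
  by_contra! hcon
  let g : V → ℤ := fun x => if x ∈ A then 1 else 0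
  have hg1 : ∀ v ∈ A, laplacian m g v = ∑ w, if w ∉ A then (m v w : ℤ) else 0 := by
    intro v hv
    rw [lap_eq]
    refine Finset.sum_congr rfl fun w _ => ?_
    by_cases hw : w ∈ A <;> simp [g, hv, hw]
  have hg2 : ∀ v, v ∉ A → laplacian m g v ≤ 0 := by
    intro v hv
    rw [lap_eq]
    refine Finset.sum_nonpos fun w _ => ?_
    by_cases hw : w ∈ A <;> simp [g, hv, hw]
  have key := hmax _ ⟨f + g, fun v hv => by
    rw [lap_add]
    by_cases hvA : v ∈ A
    · rw [hg1 v hvA]; linarith [hcon v hvA]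
    · linarith [hf v hv, hg2 v hvA], rfl⟩
  simp only [lap_add, mul_add, Finset.sum_add_distrib] at key
  rw [hc, lap_symm m hm.1 h g] at key
  have : 0 < ∑ v, g v * laplacian m h v := by
    have e : ∑ v, g v * laplacian m h v = ∑ v ∈ A, laplacian m h v := by
      simp [g, Finset.sum_ite_mem]
    rw [e]
    refine Finset.sum_pos (fun v hv => ?_) hA
    have := h1 v (fun h' => hqA (h' ▸ hv))
    omega
  linarith

theorem dichotomy [Fintype V] (m : V → V → ℕ) (hm : IsGraph m) (D : V → ℤ) :
    (Winnable m D ∨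
      ∃ r : V → V → Prop, IsStrictTotalOrder V r ∧ Winnable m (nuP m r - D)) ∧
    ¬ (Winnable m D ∧
      ∃ r : V → V → Prop, IsStrictTotalOrder V r ∧ Winnable m (nuP m r - D)) := by
  classical
  have hne : Nonempty V := hm.2.2.nonempty
  constructor
  · by_cases hw : Winnable m D
    · exact Or.inl hw
    right
    obtain ⟨q⟩ := hne
    obtain ⟨f, hf, hA⟩ := exists_reduced m hm D q
    have hfq : D q - laplacian m f q < 0 := by
      by_contra! hcon
      refine hw ⟨D - laplacian m f, fun v => ?_, f, by simp⟩
      by_cases hv : v = q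
      · subst hv; simpa using hcon
      · simpa using hf v hv
    obtain ⟨ρ, hi, hρ⟩ := exists_rank m (fun v => D v - laplacian m f v) (by
      intro A hne
      by_cases hq : q ∈ A
      · refine ⟨q, hq, lt_of_lt_of_le hfq (Finset.sum_nonneg fun w _ => ?_)⟩
        split_ifs <;> simp
      · exact hA A hne hq) _ Finset.univ rfl
    have hinj : Function.Injective ρ := by
      intro a b hab
      exact hi (by simp) (by simp) hab
    refine ⟨fun a b => ρ a < ρ b, ?_, ?_⟩
    · exact
        { trichotomous := fun a b h1 h2 => hinj (le_antisymm (not_lt.1 h2) (not_lt.1 h1))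
          irrefl := fun a => lt_irrefl _
          trans := fun a b c => lt_trans }
    · refine ⟨nuP m (fun a b => ρ a < ρ b) - (D - laplacian m f), fun v => ?_,
        fun x => (-1) * f x, ?_⟩
      · have := hρ v (Finset.mem_univ v)
        simp only [Finset.mem_univ, not_true_eq_false, false_or] at this
        have e : nuP m (fun a b => ρ a < ρ b) v
            = (∑ x, if ρ x < ρ v then (m v x : ℤ) else 0) - 1 := by
          simp only [nuP]
          congr!
        simp only [Pi.sub_apply, e]
        linarith
      · funext v
        rw [lap_smul]
        simp
  · rintro ⟨⟨E, hE, f, hf⟩, r, hr, E', hE', g, hg⟩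
    obtain ⟨v, hv⟩ := not_winnable_nu m r hr (f + g)
    have a := congrFun hf v
    have b := congrFun hg v
    rw [lap_add] at hv
    simp only [Pi.sub_apply] at a b
    linarith [hE v, hE' v]
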